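/- arXiv:1512.06620 — 2 statements merged into one kernel-verified Lean document; each statement's English description precedes it below -/
import Mathlib

section
/- Consider the four-letter alphabet {f, s, t, |} and the substitution map A_NEW sending f ↦ the word [f, |, s, |, f], s ↦ [t], t ↦ [f, |, s, |, f], and | ↦ [|], extended to words by applying it letter by letter and concatenating. Let S_i denote the number of occurrences of the letter s in the i-th iterate A_NEW^i applied to the one-letter word [f]. Then S_1 = 1, S_2 = 2, and S_i = 2·S_{i-1} + S_{i-2} for all i > 2. -/
/-- The four-letter alphabet: facet, spike, trunk, interface. -/
inductive Letter : Type
  | f | s | t | bar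
  deriving DecidableEq

/-- Extension of a substitution map to words: apply it letter by letter
and concatenate the results. -/
def applySub (A : Letter → List Letter) (w : List Letter) : List Letter :=
  w.flatMap A

/-- The (NEW) substitution: `f ↦ [f,|,s,|,f]`, `s ↦ [t]`, `t ↦ [f,|,s,|,f]`,
`| ↦ [|]`. -/
def subNEW : Letter → List Letter
  | .f => [.f, .bar, .s, .bar, .f]
  | .s => [.t]
  | .t => [.f, .bar, .s, .bar, .f]
  | .bar => [.bar]

/-- Number of occurrences of the letter `s` in `A_NEW^i ([f])`. -/
def spikeCountNEW (i : ℕ) : ℕ :=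
  ((applySub subNEW)^[i] [Letter.f]).count Letter.s

theorem applySub_append (A : Letter → List Letter) (v w : List Letter) :
    applySub A (v ++ w) = applySub A v ++ applySub A w :=
  List.flatMap_append

/-- The Pell recurrence for spike counts holds along two substitution steps from any word. -/
theorem count_s_applySub_applySub (w : List Letter) :
    (applySub subNEW (applySub subNEW w)).count Letter.s =
      2 * (applySub subNEW w).count Letter.s + w.count Letter.s := by
  induction w with
  | nil => rfl
  | cons a w ih =>
    have single : (applySub subNEW (applySub subNEW [a])).count Letter.s =
        2 * (applySub subNEW [a]).count Letter.s + [a].count Letter.s := by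
      cases a <;> decide
    rw [← List.singleton_append]
    simp only [applySub_append, List.count_append]
    omega

/-- The spike counts of the (NEW) pattern satisfy the Pell recurrence:
`S 1 = 1`, `S 2 = 2`, and `S i = 2 S (i-1) + S (i-2)` for `i > 2`. -/
theorem spikeCountNEW_pell_recurrence :
    spikeCountNEW 1 = 1 ∧ spikeCountNEW 2 = 2 ∧
      ∀ i, 2 < i → spikeCountNEW i = 2 * spikeCountNEW (i - 1) + spikeCountNEW (i - 2) := by
  refine ⟨by decide, by decide, fun i hi => ?_⟩
  obtain ⟨n, rfl⟩ := Nat.exists_eq_add_of_le' hi.le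
  simp only [spikeCountNEW, Nat.add_sub_cancel, show n + 2 - 1 = n + 1 by omega,
    Function.iterate_succ_apply']
  exact count_s_applySub_applySub _
end

section
/- Consider the four-letter alphabet {f, s, t, |} and the substitution map A_NEW sending f ↦ the word [f, |, s, |, f], s ↦ [t], t ↦ [f, |, s, |, f], and | ↦ [|], extended to words by applying it letter by letter and concatenating. For every i ≥ 1, the number of occurrences of the letter s in A_NEW^i([f]) equals the Pell number P_i, where P_1 = 1, P_2 = 2, and P_i = 2·P_{i-1} + P_{i-2} for i > 2. -/
theorem count_s_applySub_subNEW (w : List Letter) :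
    (applySub subNEW w).count .s = w.count .f + w.count .t := by
  induction w with
  | nil => rfl
  | cons a w ih =>
    simp only [applySub, List.flatMap_cons, List.count_append] at ih ⊢
    cases a <;> simp [subNEW, ih] <;> omega

theorem count_f_applySub_subNEW (w : List Letter) :
    (applySub subNEW w).count .f = 2 * (applySub subNEW w).count .s := by
  induction w with
  | nil => rfl
  | cons a w ih =>
    simp only [applySub, List.flatMap_cons, List.count_append] at ih ⊢
    cases a <;> simp [subNEW, ih] <;> omega

theorem count_t_applySub_subNEW (w : List Letter) :
    (applySub subNEW w).count .t = w.count .s := by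
  induction w with
  | nil => rfl
  | cons a w ih =>
    simp only [applySub, List.flatMap_cons, List.count_append] at ih ⊢
    cases a <;> simp [subNEW, ih, Nat.add_comm]

/-- The spike counts of successive substitutions satisfy the Pell recurrence. -/
theorem count_s_applySub_subNEW_applySub_subNEW (w : List Letter) :
    (applySub subNEW (applySub subNEW w)).count .s =
      2 * (applySub subNEW w).count .s + w.count .s := by
  rw [count_s_applySub_subNEW (applySub subNEW w), count_f_applySub_subNEW,
    count_t_applySub_subNEW]

/-- The number of spikes in `A_NEW^i ([f])` is the `i`-th Pell number, for `i ≥ 1`. -/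
theorem spikeCountNEW_eq_pell (P : ℕ → ℕ)
    (h1 : P 1 = 1) (h2 : P 2 = 2)
    (hrec : ∀ i, 2 < i → P i = 2 * P (i - 1) + P (i - 2)) :
    ∀ i, 1 ≤ i → ((applySub subNEW)^[i] [Letter.f]).count Letter.s = P i := by
  intro i hi
  induction i using Nat.strong_induction_on with
  | _ i ih =>
    match i, hi with
    | 1, _ => rw [h1]; rfl
    | 2, _ => rw [h2]; rfl
    | n + 3, _ =>
      have hP : P (n + 3) = 2 * P (n + 2) + P (n + 1) := hrec (n + 3) (by omega)
      rw [hP, ← ih (n + 2) (by omega) (by omega), ← ih (n + 1) (by omega) (by omega),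
        Function.iterate_succ_apply', Function.iterate_succ_apply' _ (n + 1),
        count_s_applySub_subNEW_applySub_subNEW]
end
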